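/- arXiv:2303.01953 — 4 statements merged into one kernel-verified Lean document; each statement's English description precedes it below -/
import Mathlib

section
/- Let q be an odd prime power. For every γ ∈ 𝔽_{q²} and every A ∈ SL(2,𝔽_{q²}), if x ∈ 𝔽_{q²}⁴ satisfies F_γ(x) = 0, then F_γ(x·(A^q ⊗ A)) = 0; that is, the group K of projectivities induced by the matrices A^q ⊗ A, A ∈ SL(2,𝔽_{q²}), stabilizes the point set C_γ of PG(3,q²) (in particular it stabilizes the Hermitian surface H(3,q²) = C₀ and the hyperbolic quadric Q⁺(3,q²)). -/
noncomputable section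

open Matrix

/-- The form `F_γ(X₁,X₂,X₃,X₄) = X₁^q X₄ + X₁ X₄^q − X₂^{q+1} − X₃^{q+1}
    − γ (X₁X₄ − X₂X₃)^{(q+1)/2}`. -/
def Fgam {F : Type*} [Field F] (q : ℕ) (γ : F) (x : Fin 4 → F) : F :=
  x 0 ^ q * x 3 + x 0 * x 3 ^ q - x 1 ^ (q + 1) - x 2 ^ (q + 1)
    - γ * (x 0 * x 3 - x 1 * x 2) ^ ((q + 1) / 2)

/-- Kronecker product of two 2×2 matrices, as a 4×4 matrix. -/
def kron {F : Type*} [Field F] (A B : Matrix (Fin 2) (Fin 2) F) :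
    Matrix (Fin 4) (Fin 4) F :=
  Matrix.of fun i j =>
    A ⟨i.val / 2, by have := i.isLt; omega⟩ ⟨j.val / 2, by have := j.isLt; omega⟩ *
    B ⟨i.val % 2, by have := i.isLt; omega⟩ ⟨j.val % 2, by have := j.isLt; omega⟩

/-- Entrywise `q`-th power (the matrix `A^q`). -/
def matq {F : Type*} [Field F] (q : ℕ) (A : Matrix (Fin 2) (Fin 2) F) :
    Matrix (Fin 2) (Fin 2) F :=
  A.map (· ^ q)

/-- The polynomial `F_γ` is invariant under `A^q ⊗ A` when `A` has determinant one and the `q`-th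
power map is an involutory additive map. -/
theorem Fgam_vecMul_kron {F : Type*} [Field F] {q : ℕ}
    (hadd : ∀ u v : F, (u + v) ^ q = u ^ q + v ^ q)
    (hsub : ∀ u v : F, (u - v) ^ q = u ^ q - v ^ q)
    (hinv : ∀ u : F, (u ^ q) ^ q = u)
    (γ : F) {A : Matrix (Fin 2) (Fin 2) F} (hA : A.det = 1) (x : Fin 4 → F) :
    Fgam q γ (Matrix.vecMul x (kron (matq q A) A)) = Fgam q γ x := by
  rw [Matrix.det_fin_two] at hA
  have hAq : A 0 0 ^ q * A 1 1 ^ q - A 0 1 ^ q * A 1 0 ^ q = 1 := by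
    rw [← mul_pow, ← mul_pow, ← hsub, hA, one_pow]
  have h0 : Matrix.vecMul x (kron (matq q A) A) 0 = x 0 * (A 0 0 ^ q * A 0 0)
      + x 1 * (A 0 0 ^ q * A 1 0) + x 2 * (A 1 0 ^ q * A 0 0) + x 3 * (A 1 0 ^ q * A 1 0) := by
    simp [Matrix.vecMul, dotProduct, Fin.sum_univ_four, kron, matq]
  have h1 : Matrix.vecMul x (kron (matq q A) A) 1 = x 0 * (A 0 0 ^ q * A 0 1)
      + x 1 * (A 0 0 ^ q * A 1 1) + x 2 * (A 1 0 ^ q * A 0 1) + x 3 * (A 1 0 ^ q * A 1 1) := by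
    simp [Matrix.vecMul, dotProduct, Fin.sum_univ_four, kron, matq]
  have h2 : Matrix.vecMul x (kron (matq q A) A) 2 = x 0 * (A 0 1 ^ q * A 0 0)
      + x 1 * (A 0 1 ^ q * A 1 0) + x 2 * (A 1 1 ^ q * A 0 0) + x 3 * (A 1 1 ^ q * A 1 0) := by
    simp [Matrix.vecMul, dotProduct, Fin.sum_univ_four, kron, matq]
  have h3 : Matrix.vecMul x (kron (matq q A) A) 3 = x 0 * (A 0 1 ^ q * A 0 1)
      + x 1 * (A 0 1 ^ q * A 1 1) + x 2 * (A 1 1 ^ q * A 0 1) + x 3 * (A 1 1 ^ q * A 1 1) := by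
    simp [Matrix.vecMul, dotProduct, Fin.sum_univ_four, kron, matq]
  unfold Fgam
  rw [h0, h1, h2, h3]
  have hdet (a b c d a' b' c' d' x₀ x₁ x₂ x₃ : F) (h : a * d - b * c = 1)
      (h' : a' * d' - b' * c' = 1) :
      (x₀ * (a' * a) + x₁ * (a' * c) + x₂ * (c' * a) + x₃ * (c' * c)) *
        (x₀ * (b' * b) + x₁ * (b' * d) + x₂ * (d' * b) + x₃ * (d' * d)) -
      (x₀ * (a' * b) + x₁ * (a' * d) + x₂ * (c' * b) + x₃ * (c' * d)) *
        (x₀ * (b' * a) + x₁ * (b' * c) + x₂ * (d' * a) + x₃ * (d' * c)) =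
      x₀ * x₃ - x₁ * x₂ := by
    linear_combination (x₀ * x₃ - x₁ * x₂) * ((a' * d' - b' * c') * h + h')
  rw [hdet _ _ _ _ _ _ _ _ _ _ _ _ hA hAq]
  congr 1
  simp only [pow_succ, hadd, mul_pow, hinv]
  linear_combination (x 0 ^ q * x 3 + x 0 * x 3 ^ q - x 1 ^ q * x 1 - x 2 ^ q * x 2) *
    ((A 0 0 ^ q * A 1 1 ^ q - A 0 1 ^ q * A 1 0 ^ q) * hA + hAq)

theorem stmt0 {F : Type*} [Field F] [Fintype F] (p n q : ℕ) (hp : p.Prime)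
    (hodd : Odd p) (hn : 0 < n) (hq : q = p ^ n) (hF : Fintype.card F = q ^ 2)
    (γ : F) (A : Matrix (Fin 2) (Fin 2) F) (hA : A.det = 1)
    (x : Fin 4 → F) (hx : Fgam q γ x = 0) :
    Fgam q γ (Matrix.vecMul x (kron (matq q A) A)) = 0 := by
  have := Fact.mk hp
  have hchar : CharP F p := by
    obtain ⟨r, hr⟩ := CharP.exists F
    have hr_prime : r.Prime := CharP.char_is_prime F r
    obtain ⟨m, -, hm⟩ := FiniteField.card F r
    have hdvd : r ∣ p ^ (n * 2) := by
      rw [pow_mul, ← hq, ← hF, hm]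
      exact dvd_pow_self r m.ne_zero
    rwa [(Nat.prime_dvd_prime_iff_eq hr_prime hp).mp (hr_prime.dvd_of_dvd_pow hdvd)] at hr
  have hadd (u v : F) : (u + v) ^ q = u ^ q + v ^ q := by
    rw [hq]; exact add_pow_char_pow u v p n
  have hsub (u v : F) : (u - v) ^ q = u ^ q - v ^ q := by
    rw [hq]; exact sub_pow_char_pow u v n
  have hinv (u : F) : (u ^ q) ^ q = u := by
    rw [← pow_mul, ← sq, ← hF, FiniteField.pow_card]
  rw [Fgam_vecMul_kron hadd hsub hinv γ hA, hx]
end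
end

section
/- Let q be an odd prime power and ξ a primitive element of 𝔽_{q²}. Let Z₁ = { ξ^{j(q−1)/2} + ξ^{−j(q−1)/2} : j ∈ {1,…,q}, j ≠ (q+1)/2 } and Z₂ = { ξ^{k(q+1)/2} + ξ^{−k(q+1)/2} : k ∈ {0,…,q−1}, k ≠ (q−1)/2 }. Then |Z₁ ∪ Z₂| = 2(q−1). -/
noncomputable section

open Matrix

/-- The points of `PG(3,q²)`: the projectivization of `F⁴` where `F = 𝔽_{q²}`. -/
abbrev PGPoint (F : Type*) [Field F] := Projectivization F (Fin 4 → F)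

/-- The point set `C_γ` of `PG(3,q²)`, the zero locus of `F_γ`. -/
def Cgam {F : Type*} [Field F] (q : ℕ) (γ : F) : Set (PGPoint F) :=
  {P | ∀ (v : Fin 4 → F) (hv : v ≠ 0), P = Projectivization.mk F v hv → Fgam q γ v = 0}

/-- The orbit of a point of `PG(3,q²)` under the group `K ≅ PSL(2,q²)` of projectivities
    induced by the matrices `A^q ⊗ A` with `A ∈ SL(2,𝔽_{q²})`. -/
def Korb {F : Type*} [Field F] (q : ℕ) (P : PGPoint F) : Set (PGPoint F) :=
  {P' | ∃ A : Matrix (Fin 2) (Fin 2) F, A.det = 1 ∧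
    ∃ (v : Fin 4 → F) (hv : v ≠ 0) (hw : Matrix.vecMul v (kron (matq q A) A) ≠ 0),
      P = Projectivization.mk F v hv ∧ P' = Projectivization.mk F _ hw}

/-- The orbit of a point of `PG(3,q²)` under the group `G ≅ PGL(2,q²)` of projectivities
    induced by the matrices `A^q ⊗ A` with `A ∈ GL(2,𝔽_{q²})`. -/
def Gorb {F : Type*} [Field F] (q : ℕ) (P : PGPoint F) : Set (PGPoint F) :=
  {P' | ∃ A : Matrix (Fin 2) (Fin 2) F, A.det ≠ 0 ∧
    ∃ (v : Fin 4 → F) (hv : v ≠ 0) (hw : Matrix.vecMul v (kron (matq q A) A) ≠ 0),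
      P = Projectivization.mk F v hv ∧ P' = Projectivization.mk F _ hw}

/-- The Hermitian Veronese curve `O = {(1,t,t^q,t^{q+1})} ∪ {(0,0,0,1)}`. -/
def Oset (F : Type*) [Field F] (q : ℕ) : Set (PGPoint F) :=
  {P | (∃ (t : F) (hv : ![1, t, t ^ q, t ^ (q + 1)] ≠ 0),
        P = Projectivization.mk F _ hv) ∨
    ∃ (hv : (![0, 0, 0, 1] : Fin 4 → F) ≠ 0), P = Projectivization.mk F _ hv}

/-- The Baer subgeometry `Σ = {(a,b,b^q,c) : a,c ∈ 𝔽_q, b ∈ 𝔽_{q²}}`. -/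
def SigmaSet (F : Type*) [Field F] (q : ℕ) : Set (PGPoint F) :=
  {P | ∃ (a b c : F) (hv : ![a, b, b ^ q, c] ≠ 0),
    a ^ q = a ∧ c ^ q = c ∧ P = Projectivization.mk F _ hv}

/-- The hyperbolic quadric `Q⁺(3,q²) : X₁X₄ − X₂X₃ = 0`. -/
def Qplus (F : Type*) [Field F] : Set (PGPoint F) :=
  {P | ∀ (v : Fin 4 → F) (hv : v ≠ 0), P = Projectivization.mk F v hv →
    v 0 * v 3 - v 1 * v 2 = 0}

/-- A line of `PG(3,q²)`: the set of points lying in a 2-dimensional subspace. -/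
def IsLine {F : Type*} [Field F] (ℓ : Set (PGPoint F)) : Prop :=
  ∃ W : Submodule F (Fin 4 → F), Module.finrank F W = 2 ∧ ℓ = {P | P.rep ∈ W}

/-- A plane of `PG(3,q²)`: the set of points lying in a 3-dimensional subspace. -/
def IsPlane {F : Type*} [Field F] (π : Set (PGPoint F)) : Prop :=
  ∃ W : Submodule F (Fin 4 → F), Module.finrank F W = 3 ∧ π = {P | P.rep ∈ W}

/-- If the powers of `ξ` exhaust `Fˣ`, then `ξ` has order `|F| - 1`. -/
lemma orderOf_eq_card_sub_one_of_forall_eq_pow {F : Type*} [Field F] [Fintype F] {ξ : F}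
    (h0 : ξ ≠ 0) (hξ : ∀ x : F, x ≠ 0 → ∃ m : ℕ, x = ξ ^ m) :
    orderOf ξ = Fintype.card F - 1 := by
  have h : orderOf (Units.mk0 ξ h0) = Nat.card Fˣ := by
    apply orderOf_eq_card_of_forall_mem_zpowers
    intro x
    obtain ⟨m, hm⟩ := hξ x x.ne_zero
    exact ⟨m, by ext; simp [hm]⟩
  rw [← orderOf_units, Units.val_mk0, Nat.card_units, Nat.card_eq_fintype_card] at h
  exact h

/-- If `ξ ^ a + ξ ^ (-a) = ξ ^ b + ξ ^ (-b)`, then `a ≡ ± b` modulo the order of `ξ`. -/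
lemma orderOf_dvd_of_pow_add_inv_eq {F : Type*} [Field F] {ξ : F} (h0 : ξ ≠ 0) {a b : ℕ}
    (h : ξ ^ a + (ξ ^ a)⁻¹ = ξ ^ b + (ξ ^ b)⁻¹) :
    (orderOf ξ : ℤ) ∣ b - a ∨ (orderOf ξ : ℤ) ∣ a + b := by
  have ha : ξ ^ a ≠ 0 := pow_ne_zero _ h0
  have hb : ξ ^ b ≠ 0 := pow_ne_zero _ h0
  have hm : (ξ ^ a - ξ ^ b) * (ξ ^ a * ξ ^ b - 1) = 0 := by
    field_simp at h
    linear_combination h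
  rcases mul_eq_zero.1 hm with h1 | h1
  · left
    rw [← Units.val_mk0 h0, orderOf_units, orderOf_dvd_iff_zpow_eq_one, Units.ext_iff]
    simp [zpow_sub₀ h0, sub_eq_zero.1 h1, h0]
  · right
    rw [← Units.val_mk0 h0, orderOf_units, orderOf_dvd_iff_zpow_eq_one, Units.ext_iff]
    simpa [zpow_add₀ h0] using sub_eq_zero.1 h1

/-- If `m r ∣ d r` with `r ≠ 0` and `|d| < m`, then `d = 0`. -/
lemma eq_zero_of_mul_dvd_mul_of_abs_lt {m r d : ℤ} (hr : r ≠ 0) (h : m * r ∣ d * r) (hd : |d| < m) :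
    d = 0 :=
  Int.eq_zero_of_abs_lt_dvd ((mul_dvd_mul_iff_right hr).1 h) hd

/-- If `4 r (r + 1)` divides `j r + k (r + 1)`, then `r + 1 ∣ j`. -/
lemma add_one_dvd_of_mul_dvd_add_mul {r j k : ℤ} (h : 4 * r * (r + 1) ∣ j * r + k * (r + 1)) :
    r + 1 ∣ j := by
  have h2 : r + 1 ∣ j * r + k * (r + 1) := dvd_trans ⟨4 * r, by ring⟩ h
  have := dvd_sub (Dvd.intro_left (j + k) rfl : r + 1 ∣ (j + k) * (r + 1)) h2
  rwa [show (j + k) * (r + 1) - (j * r + k * (r + 1)) = j by ring] at this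

/-- Lemma 2.3: `|Z₁ ∪ Z₂| = 2(q−1)`. -/
theorem stmt1 {F : Type*} [Field F] [Fintype F] (p n q : ℕ) (hp : p.Prime)
    (hodd : Odd p) (hn : 0 < n) (hq : q = p ^ n) (hF : Fintype.card F = q ^ 2)
    (ξ : F) (hξ : ∀ x : F, x ≠ 0 → ∃ m : ℕ, x = ξ ^ m) :
    ({z : F | ∃ j : ℕ, 1 ≤ j ∧ j ≤ q ∧ j ≠ (q + 1) / 2 ∧
        z = ξ ^ (j * (q - 1) / 2) + (ξ ^ (j * (q - 1) / 2))⁻¹} ∪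
      {z : F | ∃ k : ℕ, k ≤ q - 1 ∧ k ≠ (q - 1) / 2 ∧
        z = ξ ^ (k * (q + 1) / 2) + (ξ ^ (k * (q + 1) / 2))⁻¹}).ncard = 2 * (q - 1) := by
  have hp2 := hp.two_le
  have hq_odd : Odd q := hq ▸ hodd.pow
  obtain ⟨r, rfl⟩ := hq_odd
  have hr : 0 < r := by
    have : 1 < p ^ n := Nat.one_lt_pow hn.ne' hp2
    omega
  have h0 : ξ ≠ 0 := by
    rintro rfl
    have hle : Fintype.card F ≤ 2 := by
      classical
      calc Fintype.card F = (Finset.univ : Finset F).card := rfl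
        _ ≤ ({0, 1} : Finset F).card := Finset.card_le_card fun x _ => by
          by_cases hx : x = 0
          · simp [hx]
          · obtain ⟨m, rfl⟩ := hξ x hx
            rcases m with _ | m <;> simp
        _ ≤ 2 := Finset.card_le_two
    nlinarith
  have hN : (orderOf ξ : ℤ) = 4 * r * (r + 1) := by
    rw [orderOf_eq_card_sub_one_of_forall_eq_pow h0 hξ, hF,
      show (2 * r + 1) ^ 2 - 1 = 4 * r * (r + 1) by
        rw [Nat.sub_eq_iff_eq_add (Nat.one_le_pow _ _ (by omega))]; ring]
    push_cast
    ring
  let f : ℕ → F := fun a => ξ ^ a + (ξ ^ a)⁻¹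
  have hf : ∀ a b : ℕ, f a = f b →
      (4 * r * (r + 1) : ℤ) ∣ b - a ∨ (4 * r * (r + 1) : ℤ) ∣ a + b := by
    intro a b h
    rw [← hN]
    exact orderOf_dvd_of_pow_add_inv_eq h0 h
  have hr0 : (r : ℤ) ≠ 0 := by omega
  have hr1 : (r + 1 : ℤ) ≠ 0 := by omega
  have e1 : ∀ j, j * (2 * r) / 2 = j * r := fun j => by
    rw [mul_left_comm, Nat.mul_div_cancel_left _ two_pos]
  have e2 : ∀ k, k * (2 * r + 1 + 1) / 2 = k * (r + 1) := fun k => by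
    rw [show k * (2 * r + 1 + 1) = 2 * (k * (r + 1)) by ring, Nat.mul_div_cancel_left _ two_pos]
  have e3 : (2 * r + 1 + 1) / 2 = r + 1 := by omega
  have e4 : 2 * r / 2 = r := by omega
  simp only [e1, e2, e3, e4, Nat.add_sub_cancel]
  classical
  let A : Finset ℕ := (Finset.Icc 1 (2 * r + 1)).erase (r + 1)
  let B : Finset ℕ := (Finset.range (2 * r + 1)).erase r
  have hA : A.card = 2 * r := by
    rw [Finset.card_erase_of_mem (by simp; omega), Nat.card_Icc]; omega
  have hB : B.card = 2 * r := by
    rw [Finset.card_erase_of_mem (by simp; omega), Finset.card_range]; omega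
  have hmA : ∀ j, j ∈ A ↔ 1 ≤ j ∧ j ≤ 2 * r + 1 ∧ j ≠ r + 1 := fun j => by
    simp only [A, Finset.mem_erase, Finset.mem_Icc]; tauto
  have hmB : ∀ k, k ∈ B ↔ k ≤ 2 * r ∧ k ≠ r := fun k => by
    simp only [B, Finset.mem_erase, Finset.mem_range]; omega
  have hset : ({z : F | ∃ j : ℕ, 1 ≤ j ∧ j ≤ 2 * r + 1 ∧ j ≠ r + 1 ∧
        z = ξ ^ (j * r) + (ξ ^ (j * r))⁻¹} ∪
      {z : F | ∃ k : ℕ, k ≤ 2 * r ∧ k ≠ r ∧ z = ξ ^ (k * (r + 1)) + (ξ ^ (k * (r + 1)))⁻¹}) =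
      ((A.image (fun j => f (j * r)) ∪ B.image (fun k => f (k * (r + 1))) : Finset F) : Set F) := by
    ext z
    simp only [Set.mem_union, Set.mem_ofPred_eq, Finset.coe_union, Finset.coe_image, Set.mem_image,
      Finset.mem_coe, hmA, hmB, f, eq_comm (a := z), and_assoc]
  have hdisj : Disjoint (A.image (fun j => f (j * r))) (B.image (fun k => f (k * (r + 1)))) := by
    simp only [Finset.disjoint_left, Finset.mem_image, not_exists, not_and]
    rintro _ ⟨j, hj, rfl⟩ k hk h
    rw [hmA] at hj
    have hj' : ((r + 1 : ℕ) : ℤ) ∣ j := by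
      rcases hf _ _ h with h | h
      · push_cast at h ⊢
        exact add_one_dvd_of_mul_dvd_add_mul (k := -k) (by convert h using 1; ring)
      · push_cast at h ⊢
        exact add_one_dvd_of_mul_dvd_add_mul (k := k) (by convert h using 1; ring)
    obtain ⟨c, rfl⟩ := Int.natCast_dvd_natCast.1 hj'
    have hc : c < 2 := by by_contra!; nlinarith
    interval_cases c <;> omega
  have hinjA : Set.InjOn (fun j => f (j * r)) A := by
    intro i hi j hj h
    rw [Finset.mem_coe, hmA] at hi hj
    rcases hf _ _ h with h | h
    · have := eq_zero_of_mul_dvd_mul_of_abs_lt (m := 4 * (r + 1)) (d := j - i) hr0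
        (by push_cast at h; convert h using 1 <;> ring) (by rw [abs_lt]; omega)
      omega
    · have := eq_zero_of_mul_dvd_mul_of_abs_lt (m := 4 * (r + 1)) (d := i + j) hr0
        (by push_cast at h; convert h using 1 <;> ring) (by rw [abs_lt]; omega)
      omega
  have hinjB : Set.InjOn (fun k => f (k * (r + 1))) B := by
    intro i hi j hj h
    rw [Finset.mem_coe, hmB] at hi hj
    rcases hf _ _ h with h | h
    · have := eq_zero_of_mul_dvd_mul_of_abs_lt (m := 4 * r) (d := j - i) hr1
        (by push_cast at h; convert h using 1; ring) (by rw [abs_lt]; omega)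
      omega
    · by_contra hne
      have := eq_zero_of_mul_dvd_mul_of_abs_lt (m := 4 * r) (d := i + j) hr1
        (by push_cast at h; convert h using 1; ring) (by rw [abs_lt]; omega)
      omega
  rw [hset, Set.ncard_coe_finset, Finset.card_union_of_disjoint hdisj,
    Finset.card_image_of_injOn hinjA, Finset.card_image_of_injOn hinjB, hA, hB]
  ring
end
end

section
/- Let q be an odd prime power and ξ a primitive element of 𝔽_{q²}. Let U = (0,1,0,0), T₁ = (ξ,1,1,0), T₂ = (ξ^{q−1},ξ^{q−1},1,0), R_j = (ξ^j,0,0,1) for j ∈ {1,…,q}, and Q_k = (0,ξ^k,1,0) for k ∈ {1,…,q−2}, regarded as points of PG(3,q²). Then the number of matrices A ∈ SL(2,𝔽_{q²}) whose induced projectivity (via A^q ⊗ A) fixes the given point equals: q²−1 for U; 2(q+1) for each R_j; 2(q−1) for each Q_k; and 2q for each of T₁ and T₂. Equivalently, the stabilizers in K ≅ PSL(2,q²) have orders (q²−1)/2, q+1, q−1, q, q respectively. -/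
noncomputable section

open Matrix

/-- Membership in the stabilizer of `(x, y, z, w)`, rewritten as `A* M = c • M A⁻¹`
for the matrix `M = (x, y; z, w)`. -/
theorem vecMul_kron_eq_smul_iff {F : Type*} [Field F] {q : ℕ} {A : Matrix (Fin 2) (Fin 2) F}
    (hA : A.det = 1) (x y z w c : F) :
    Matrix.vecMul ![x, y, z, w] (kron (matq q A) A) = c • ![x, y, z, w] ↔
      A 0 0 ^ q * x + A 1 0 ^ q * z = c * (x * A 1 1 - y * A 1 0) ∧
      A 0 0 ^ q * y + A 1 0 ^ q * w = c * (y * A 0 0 - x * A 0 1) ∧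
      A 0 1 ^ q * x + A 1 1 ^ q * z = c * (z * A 1 1 - w * A 1 0) ∧
      A 0 1 ^ q * y + A 1 1 ^ q * w = c * (w * A 0 0 - z * A 0 1) := by
  rw [Matrix.det_fin_two] at hA
  have key : Matrix.vecMul ![x, y, z, w] (kron (matq q A) A) = c • ![x, y, z, w] ↔
      x * (A 0 0 ^ q * A 0 0) + y * (A 0 0 ^ q * A 1 0) + z * (A 1 0 ^ q * A 0 0)
        + w * (A 1 0 ^ q * A 1 0) = c * x ∧
      x * (A 0 0 ^ q * A 0 1) + y * (A 0 0 ^ q * A 1 1) + z * (A 1 0 ^ q * A 0 1)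
        + w * (A 1 0 ^ q * A 1 1) = c * y ∧
      x * (A 0 1 ^ q * A 0 0) + y * (A 0 1 ^ q * A 1 0) + z * (A 1 1 ^ q * A 0 0)
        + w * (A 1 1 ^ q * A 1 0) = c * z ∧
      x * (A 0 1 ^ q * A 0 1) + y * (A 0 1 ^ q * A 1 1) + z * (A 1 1 ^ q * A 0 1)
        + w * (A 1 1 ^ q * A 1 1) = c * w := by
    simp only [funext_iff, Fin.forall_fin_succ, Matrix.vecMul, dotProduct, Fin.sum_univ_four]
    exact ⟨fun ⟨h1, h2, h3, h4, _⟩ => ⟨h1, h2, h3, h4⟩,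
      fun ⟨h1, h2, h3, h4⟩ => ⟨h1, h2, h3, h4, fun i => i.elim0⟩⟩
  rw [key]
  generalize A 0 0 ^ q = a' at *
  generalize A 0 1 ^ q = b' at *
  generalize A 1 0 ^ q = c' at *
  generalize A 1 1 ^ q = d' at *
  generalize A 0 0 = a at *
  generalize A 0 1 = b at *
  generalize A 1 0 = e at *
  generalize A 1 1 = d at *
  constructor
  · rintro ⟨h1, h2, h3, h4⟩
    refine ⟨?_, ?_, ?_, ?_⟩
    · linear_combination d * h1 - e * h2 - (a' * x + c' * z) * hA
    · linear_combination a * h2 - b * h1 - (a' * y + c' * w) * hA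
    · linear_combination d * h3 - e * h4 - (b' * x + d' * z) * hA
    · linear_combination a * h4 - b * h3 - (b' * y + d' * w) * hA
  · rintro ⟨h1, h2, h3, h4⟩
    refine ⟨?_, ?_, ?_, ?_⟩
    · linear_combination a * h1 + e * h2 + c * x * hA
    · linear_combination b * h1 + d * h2 + c * y * hA
    · linear_combination a * h3 + e * h4 + c * z * hA
    · linear_combination b * h3 + d * h4 + c * w * hA

/-- If `M = (x, y; z, w)` is invertible, the scalar of any stabilizing matrix squares to one. -/
theorem sq_eq_one_of_stabilizes {F : Type*} [Field F] {σ : F →+* F} {a b e d x y z w c : F}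
    (hA : a * d - b * e = 1) (hM : x * w - y * z ≠ 0)
    (h1 : σ a * x + σ e * z = c * (x * d - y * e))
    (h2 : σ a * y + σ e * w = c * (y * a - x * b))
    (h3 : σ b * x + σ d * z = c * (z * d - w * e))
    (h4 : σ b * y + σ d * w = c * (w * a - z * b)) : c ^ 2 = 1 := by
  have hσ : σ a * σ d - σ b * σ e = 1 := by rw [← map_mul, ← map_mul, ← map_sub, hA, map_one]
  have h : (σ a * x + σ e * z) * (σ b * y + σ d * w) - (σ a * y + σ e * w) * (σ b * x + σ d * z)
      = (σ a * σ d - σ b * σ e) * (x * w - y * z) := by ring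
  rw [h1, h2, h3, h4, hσ] at h
  apply mul_right_cancel₀ hM
  linear_combination h - c ^ 2 * (x * w - y * z) * hA

theorem ncard_image_diagonal {F : Type*} [Field F] (S : Set F) :
    ((fun a : F => !![a, 0; 0, a⁻¹]) '' S).ncard = S.ncard := by
  apply Set.ncard_image_of_injective
  intro a b h
  simpa using congrFun (congrFun h 0) 0

theorem ncard_image_unitriangular {F : Type*} [Field F] (h2 : (2 : F) ≠ 0) (S : Set F) :
    ((fun r : F × F => !![r.1, 0; r.2, r.1]) '' (({1, -1} : Set F) ×ˢ S)).ncard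
      = 2 * S.ncard := by
  rw [Set.ncard_image_of_injective, Set.ncard_prod, Set.ncard_pair]
  · intro h
    apply h2
    linear_combination h
  · rintro ⟨a, b⟩ ⟨c, d⟩ h
    have e1 := congrFun (congrFun h 0) 0
    have e2 := congrFun (congrFun h 1) 0
    simp at e1 e2
    simp [e1, e2]

theorem ncard_pow_eq_one {F : Type*} [Field F] {ξ : F} {N m : ℕ} (hξ : IsPrimitiveRoot ξ N)
    (hN : 0 < N) (hm : m ∣ N) : {a : F | a ^ m = 1}.ncard = m := by
  obtain ⟨k, rfl⟩ := hm
  have hm0 : 0 < m := Nat.pos_of_mul_pos_right hN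
  have h := hξ.pow hN (mul_comm m k)
  refine Eq.trans ?_ h.card_nthRootsFinset
  rw [← Set.ncard_coe_finset]
  congr 1
  ext a
  simp [Polynomial.mem_nthRootsFinset hm0]

theorem ncard_pow_eq_mul {F : Type*} [Field F] [Finite F] {q : ℕ} (hq : 1 < q)
    (h : {a : F | a ^ (q - 1) = 1}.ncard = q - 1) {e : F} (he : e ≠ 0) :
    {t : F | t ^ q = e ^ (q - 1) * t}.ncard = q := by
  obtain ⟨m, rfl⟩ : ∃ m, q = m + 1 := ⟨q - 1, by omega⟩
  have hm : m ≠ 0 := by omega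
  simp only [Nat.add_sub_cancel] at *
  have hS : {t : F | t ^ (m + 1) = e ^ m * t} = insert 0 ((e * ·) '' {a : F | a ^ m = 1}) := by
    ext t
    simp only [Set.mem_ofPred_eq, Set.mem_insert_iff, Set.mem_image]
    constructor
    · intro ht
      by_cases h0 : t = 0
      · exact Or.inl h0
      · refine Or.inr ⟨t / e, ?_, by field_simp⟩
        rw [div_pow, div_eq_one_iff_eq (pow_ne_zero _ he)]
        exact mul_right_cancel₀ h0 (by rw [← ht, pow_succ])
    · rintro (rfl | ⟨a, ha, rfl⟩)
      · simp
      · rw [mul_pow, pow_succ, pow_succ, ha]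
        ring
  rw [hS, Set.ncard_insert_of_notMem, Set.ncard_image_of_injective _ (mul_right_injective₀ he), h]
  rintro ⟨a, ha, h0⟩
  have ha0 : a = 0 := by simpa [he] using h0
  simp [ha0, hm] at ha

theorem isPrimitiveRoot_of_forall_eq_pow {F : Type*} [Field F] [Fintype F] {ξ : F} (h0 : ξ ≠ 0)
    (hξ : ∀ x : F, x ≠ 0 → ∃ m : ℕ, x = ξ ^ m) : IsPrimitiveRoot ξ (Fintype.card F - 1) := by
  classical
  have h : orderOf (Units.mk0 ξ h0) = Nat.card Fˣ := by
    apply orderOf_eq_card_of_forall_mem_zpowers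
    intro x
    obtain ⟨m, hm⟩ := hξ x x.ne_zero
    exact ⟨m, by ext; simp [hm]⟩
  rw [Nat.card_eq_fintype_card, Fintype.card_units, ← orderOf_units, Units.val_mk0] at h
  rw [← h]
  exact IsPrimitiveRoot.orderOf ξ

/-- The stabilizer of `(0, 1, 0, 0)`. -/
theorem stabilizer_U {F : Type*} [Field F] (q : ℕ) (hq : q ≠ 0) :
    {A : Matrix (Fin 2) (Fin 2) F | A.det = 1 ∧ ∃ c : F, c ≠ 0 ∧
        Matrix.vecMul ![0, 1, 0, 0] (kron (matq q A) A) = c • ![0, 1, 0, 0]}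
      = (fun a : F => !![a, 0; 0, a⁻¹]) '' {a : F | a ≠ 0} := by
  ext A
  constructor
  · rintro ⟨hA, c, hc, h⟩
    rw [vecMul_kron_eq_smul_iff hA] at h
    obtain ⟨h1, -, -, h4⟩ := h
    rw [Matrix.det_fin_two] at hA
    have he : A 1 0 = 0 := by simpa [hq, hc] using h1
    have hb : A 0 1 = 0 := by simpa [hq] using h4
    rw [he, hb] at hA
    have ha : A 0 0 ≠ 0 := by rintro ha; simp [ha] at hA
    refine ⟨A 0 0, ha, ?_⟩
    have hd : (A 0 0)⁻¹ = A 1 1 := by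
      field_simp
      linear_combination -hA
    ext i j
    fin_cases i <;> fin_cases j <;> simp [he, hb, hd]
  · rintro ⟨a, ha : a ≠ 0, rfl⟩
    have hA : (!![a, 0; 0, a⁻¹]).det = 1 := by simp [ha]
    refine ⟨hA, a ^ q / a, by positivity, ?_⟩
    rw [vecMul_kron_eq_smul_iff hA]
    simp [hq, ha]

section
variable {F : Type*} [Field F] {q : ℕ} {σ : F →+* F}

theorem map_eq_self_of_sq_eq_one {c : F} (hc : c ^ 2 = 1) : σ c = c := by
  rcases (show c = 1 ∨ c = -1 by simpa using hc) with rfl | rfl <;> simp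

/-- The stabilizer of `(s, 0, 0, 1)`. -/
theorem stabilizer_R (hσ : ∀ x, σ x = x ^ q) (hσσ : ∀ x, σ (σ x) = x) {s : F}
    (hs : σ s ≠ s) :
    {A : Matrix (Fin 2) (Fin 2) F | A.det = 1 ∧ ∃ c : F, c ≠ 0 ∧
        Matrix.vecMul ![s, 0, 0, 1] (kron (matq q A) A) = c • ![s, 0, 0, 1]}
      = (fun a : F => !![a, 0; 0, a⁻¹]) '' {a : F | a ^ (2 * (q + 1)) = 1} := by
  have hs0 : s ≠ 0 := by rintro rfl; simp at hs
  ext A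
  constructor
  · rintro ⟨hA, c, -, h⟩
    rw [vecMul_kron_eq_smul_iff hA] at h
    simp only [← hσ] at h
    obtain ⟨h1, h2, h3, h4⟩ := h
    rw [Matrix.det_fin_two] at hA
    have hc := sq_eq_one_of_stabilizes hA (by simpa using hs0) h1 h2 h3 h4
    have hcσ : σ c = c := map_eq_self_of_sq_eq_one hc
    have h3' := congrArg σ h3
    simp only [map_mul, map_add, map_sub, hσσ, hcσ, map_one, map_zero] at h3'
    have hb : A 0 1 = 0 := by
      have : A 0 1 * (σ s - s) = 0 := by
        linear_combination h3' - c * h2 + s * A 0 1 * hc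
      simpa [sub_ne_zero.mpr hs] using this
    have he : A 1 0 = 0 := by
      have : σ (A 1 0) = 0 := by
        simpa [hb] using h2
      simpa using this
    simp only [he, hb, map_zero] at hA h1
    have ha : A 0 0 ≠ 0 := by rintro ha; simp [ha] at hA
    have h1' : σ (A 0 0) = c * A 1 1 := by
      apply mul_right_cancel₀ hs0
      linear_combination h1
    refine ⟨A 0 0, ?_, ?_⟩
    · have : A 0 0 ^ (q + 1) = c := by
        rw [pow_succ, ← hσ, h1']
        linear_combination c * hA
      rw [Set.mem_ofPred_eq, mul_comm, pow_mul, this, hc]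
    have hd : (A 0 0)⁻¹ = A 1 1 := by
      field_simp
      linear_combination -hA
    ext i j
    fin_cases i <;> fin_cases j <;> simp [he, hb, hd]
  · rintro ⟨a, ha : a ^ (2 * (q + 1)) = 1, rfl⟩
    have ha0 : a ≠ 0 := by rintro rfl; simp at ha
    have hA : (!![a, 0; 0, a⁻¹]).det = 1 := by simp [ha0]
    refine ⟨hA, a ^ (q + 1), pow_ne_zero _ ha0, ?_⟩
    rw [vecMul_kron_eq_smul_iff hA]
    simp only [← hσ]
    have hc : (σ a * a) ^ 2 = 1 := by
      rw [hσ, ← pow_succ, ← pow_mul, mul_comm, ha]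
    have hσa : σ a ≠ 0 := by simpa using ha0
    simp only [pow_succ, ← hσ]
    simp
    refine ⟨?_, ?_⟩ <;> field_simp
    linear_combination -hc

/-- The stabilizer of `(0, s, 1, 0)`. -/
theorem stabilizer_Q (hσ : ∀ x, σ x = x ^ q) (hσσ : ∀ x, σ (σ x) = x) (hq : 1 < q) {s : F}
    (hs0 : s ≠ 0) (hs : s * σ s ≠ 1) :
    {A : Matrix (Fin 2) (Fin 2) F | A.det = 1 ∧ ∃ c : F, c ≠ 0 ∧
        Matrix.vecMul ![0, s, 1, 0] (kron (matq q A) A) = c • ![0, s, 1, 0]}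
      = (fun a : F => !![a, 0; 0, a⁻¹]) '' {a : F | a ^ (2 * (q - 1)) = 1} := by
  have hσq : ∀ x, σ x = x ^ (q - 1) * x := fun x => by
    rw [hσ, ← pow_succ, Nat.sub_add_cancel hq.le]
  ext A
  constructor
  · rintro ⟨hA, c, -, h⟩
    rw [vecMul_kron_eq_smul_iff hA] at h
    simp only [← hσ] at h
    obtain ⟨h1, h2, h3, h4⟩ := h
    rw [Matrix.det_fin_two] at hA
    have hc := sq_eq_one_of_stabilizes hA (by simpa using hs0) h1 h2 h3 h4
    have hcσ : σ c = c := map_eq_self_of_sq_eq_one hc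
    have h1' := congrArg σ h1
    have h4' := congrArg σ h4
    simp only [map_mul, map_add, map_sub, hσσ, hcσ, map_one, map_zero] at h1' h4'
    have he : A 1 0 = 0 := by
      have : A 1 0 * (s * σ s - 1) = 0 := by
        linear_combination -h1' + c * σ s * h1 - s * σ s * A 1 0 * hc
      simpa [sub_ne_zero.mpr hs] using this
    have hb : A 0 1 = 0 := by
      have : A 0 1 * (s * σ s - 1) = 0 := by
        linear_combination s * h4' - c * h4 + A 0 1 * hc
      simpa [sub_ne_zero.mpr hs] using this
    simp only [he, hb, map_zero] at hA h2
    have ha : A 0 0 ≠ 0 := by rintro ha; simp [ha] at hA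
    have h2' : A 0 0 ^ (q - 1) = c := by
      apply mul_right_cancel₀ ha
      apply mul_right_cancel₀ hs0
      rw [← hσq]
      linear_combination h2
    refine ⟨A 0 0, ?_, ?_⟩
    · rw [Set.mem_ofPred_eq, mul_comm, pow_mul, h2', hc]
    have hd : (A 0 0)⁻¹ = A 1 1 := by
      field_simp
      linear_combination -hA
    ext i j
    fin_cases i <;> fin_cases j <;> simp [he, hb, hd]
  · rintro ⟨a, ha : a ^ (2 * (q - 1)) = 1, rfl⟩
    have ha0 : a ≠ 0 := by
      rintro rfl
      rw [zero_pow (by omega)] at ha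
      exact zero_ne_one ha
    have hA : (!![a, 0; 0, a⁻¹]).det = 1 := by simp [ha0]
    refine ⟨hA, a ^ (q - 1), pow_ne_zero _ ha0, ?_⟩
    rw [vecMul_kron_eq_smul_iff hA]
    have hc : (a ^ (q - 1)) ^ 2 = 1 := by
      rw [← pow_mul, mul_comm, ha]
    simp only [← hσ]
    simp
    rw [hσq]
    generalize a ^ (q - 1) = u at hc
    have hu : u ≠ 0 := by rintro rfl; simp at hc
    refine ⟨?_, ?_⟩ <;> field_simp
    linear_combination -hc

/-- The stabilizer of `(s, 1, 1, 0)`. -/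
theorem stabilizer_T₁ (hσ : ∀ x, σ x = x ^ q) (hσσ : ∀ x, σ (σ x) = x) {s : F}
    (hs : σ s ≠ s) :
    {A : Matrix (Fin 2) (Fin 2) F | A.det = 1 ∧ ∃ c : F, c ≠ 0 ∧
        Matrix.vecMul ![s, 1, 1, 0] (kron (matq q A) A) = c • ![s, 1, 1, 0]}
      = (fun r : F × F => !![r.1, 0; r.2, r.1]) '' (({1, -1} : Set F) ×ˢ {t | t ^ q = -t}) := by
  ext A
  constructor
  · rintro ⟨hA, c, -, h⟩
    rw [vecMul_kron_eq_smul_iff hA] at h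
    simp only [← hσ] at h
    obtain ⟨h1, h2, h3, h4⟩ := h
    rw [Matrix.det_fin_two] at hA
    have hc := sq_eq_one_of_stabilizes hA (by simp) h1 h2 h3 h4
    have hcσ : σ c = c := map_eq_self_of_sq_eq_one hc
    have h1' := congrArg σ h1
    have h3' := congrArg σ h3
    simp only [map_mul, map_add, map_sub, hσσ, hcσ, map_one, map_zero] at h1' h3'
    have hb : A 0 1 = 0 := by
      have : A 0 1 * (σ s - s) = 0 := by
        linear_combination h3' + c * h3 + (A 1 1 + s * A 0 1) * hc - c * s * h4
      simpa [sub_ne_zero.mpr hs] using this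
    simp only [hb, map_zero] at hA h2 h3
    have hd : A 1 1 = A 0 0 := by
      have : (A 1 1 - A 0 0) * (σ s - s) = 0 := by
        linear_combination -h1' + c * h1 - c * s * h2 - c * σ s * h3
          - (A 1 0 + σ s * A 1 1 - s * (A 1 1 - A 0 0)) * hc
      rcases mul_eq_zero.mp this with h | h
      · exact sub_eq_zero.mp h
      · exact absurd (sub_eq_zero.mp h) hs
    rw [hd] at hA h1
    have ha2 : A 0 0 ^ 2 = 1 := by linear_combination hA
    have ha0 : A 0 0 ≠ 0 := by rintro ha; simp [ha] at ha2
    have hc1 : c = 1 := by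
      rw [map_eq_self_of_sq_eq_one ha2] at h2
      apply mul_right_cancel₀ ha0
      linear_combination -h2
    rw [map_eq_self_of_sq_eq_one ha2, hc1] at h1
    refine ⟨(A 0 0, A 1 0), ⟨by simpa using ha2, ?_⟩, ?_⟩
    · rw [Set.mem_ofPred_eq, ← hσ]
      linear_combination h1
    · ext i j
      fin_cases i <;> fin_cases j <;> simp [hb, hd]
  · rintro ⟨⟨a, t⟩, ⟨ha, ht⟩, rfl⟩
    have ha2 : a ^ 2 = 1 := by simpa using ha
    rw [Set.mem_ofPred_eq, ← hσ] at ht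
    have hA : (!![a, 0; t, a]).det = 1 := by
      rw [Matrix.det_fin_two_of]
      linear_combination ha2
    refine ⟨hA, 1, one_ne_zero, ?_⟩
    rw [vecMul_kron_eq_smul_iff hA]
    simp only [← hσ]
    simp at ht ⊢
    rw [map_eq_self_of_sq_eq_one ha2, ht]
    refine ⟨by ring, rfl⟩

/-- The stabilizer of `(s, s, 1, 0)`. -/
theorem stabilizer_T₂ (hσ : ∀ x, σ x = x ^ q) (hσσ : ∀ x, σ (σ x) = x) {s : F}
    (hs : s * σ s = 1) (hs1 : s ≠ 1) :
    {A : Matrix (Fin 2) (Fin 2) F | A.det = 1 ∧ ∃ c : F, c ≠ 0 ∧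
        Matrix.vecMul ![s, s, 1, 0] (kron (matq q A) A) = c • ![s, s, 1, 0]}
      = (fun r : F × F => !![r.1, 0; r.2, r.1]) ''
        (({1, -1} : Set F) ×ˢ {t | t ^ q = -s * t}) := by
  have hs0 : s ≠ 0 := left_ne_zero_of_mul_eq_one hs
  ext A
  constructor
  · rintro ⟨hA, c, -, h⟩
    rw [vecMul_kron_eq_smul_iff hA] at h
    simp only [← hσ] at h
    obtain ⟨h1, h2, h3, h4⟩ := h
    rw [Matrix.det_fin_two] at hA
    have hc := sq_eq_one_of_stabilizes hA (by simpa using hs0) h1 h2 h3 h4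
    have hcσ : σ c = c := map_eq_self_of_sq_eq_one hc
    have h1' := congrArg σ h1
    have h3' := congrArg σ h3
    simp only [map_mul, map_add, map_sub, hσσ, hcσ, map_one, map_zero] at h1' h3'
    have hb : A 0 1 = 0 := by
      have : A 0 1 * (s - 1) = 0 := by
        linear_combination -s * h3' - c * s * h3 + c * s * h4 + A 0 1 * hs
          - s * (A 1 1 + A 0 1) * hc
      simpa [sub_ne_zero.mpr hs1] using this
    simp only [hb, map_zero] at hA h2 h3
    have hd : A 1 1 = A 0 0 := by
      have : (A 1 1 - A 0 0) * (s - 1) = 0 := by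
        linear_combination s * h1' + c * s * σ s * (h2 + h3 - h1)
          - (A 0 0 - c ^ 2 * A 1 1 + c ^ 2 * s * (A 1 1 - A 1 0 - A 0 0)) * hs
          - (s * (A 1 1 - A 1 0 - A 0 0) - A 1 1) * hc
      rcases mul_eq_zero.mp this with h | h
      · exact sub_eq_zero.mp h
      · exact absurd (sub_eq_zero.mp h) hs1
    rw [hd] at hA h1
    have ha2 : A 0 0 ^ 2 = 1 := by linear_combination hA
    have ha0 : A 0 0 ≠ 0 := by rintro ha; simp [ha] at ha2
    have hc1 : c = 1 := by
      rw [map_eq_self_of_sq_eq_one ha2] at h2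
      apply mul_right_cancel₀ ha0
      apply mul_right_cancel₀ hs0
      linear_combination -h2
    rw [map_eq_self_of_sq_eq_one ha2, hc1] at h1
    refine ⟨(A 0 0, A 1 0), ⟨by simpa using ha2, ?_⟩, ?_⟩
    · rw [Set.mem_ofPred_eq, ← hσ]
      linear_combination h1
    · ext i j
      fin_cases i <;> fin_cases j <;> simp [hb, hd]
  · rintro ⟨⟨a, t⟩, ⟨ha, ht⟩, rfl⟩
    have ha2 : a ^ 2 = 1 := by simpa using ha
    rw [Set.mem_ofPred_eq, ← hσ] at ht
    have hA : (!![a, 0; t, a]).det = 1 := by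
      rw [Matrix.det_fin_two_of]
      linear_combination ha2
    refine ⟨hA, 1, one_ne_zero, ?_⟩
    rw [vecMul_kron_eq_smul_iff hA]
    simp only [← hσ]
    simp at ht ⊢
    rw [map_eq_self_of_sq_eq_one ha2, ht]
    refine ⟨by ring, by ring, rfl⟩

end

/-- Lemma 2.4: orders of the stabilizers in `K ≅ PSL(2,q²)` of the points
    `U`, `R_j`, `Q_k`, `T₁`, `T₂`, counted at the level of `SL(2,𝔽_{q²})`
    (where each projectivity has exactly two matrix preimages `±A`). -/
theorem stmt2 {F : Type*} [Field F] [Fintype F] (p n q : ℕ) (hp : p.Prime)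
    (hodd : Odd p) (hn : 0 < n) (hq : q = p ^ n) (hF : Fintype.card F = q ^ 2)
    (ξ : F) (hξ : ∀ x : F, x ≠ 0 → ∃ m : ℕ, x = ξ ^ m) :
    ({A : Matrix (Fin 2) (Fin 2) F | A.det = 1 ∧ ∃ c : F, c ≠ 0 ∧
        Matrix.vecMul ![0, 1, 0, 0] (kron (matq q A) A) = c • ![0, 1, 0, 0]}).ncard
      = q ^ 2 - 1 ∧
    (∀ j : ℕ, 1 ≤ j → j ≤ q →
      ({A : Matrix (Fin 2) (Fin 2) F | A.det = 1 ∧ ∃ c : F, c ≠ 0 ∧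
          Matrix.vecMul ![ξ ^ j, 0, 0, 1] (kron (matq q A) A)
            = c • ![ξ ^ j, 0, 0, 1]}).ncard = 2 * (q + 1)) ∧
    (∀ k : ℕ, 1 ≤ k → k ≤ q - 2 →
      ({A : Matrix (Fin 2) (Fin 2) F | A.det = 1 ∧ ∃ c : F, c ≠ 0 ∧
          Matrix.vecMul ![0, ξ ^ k, 1, 0] (kron (matq q A) A)
            = c • ![0, ξ ^ k, 1, 0]}).ncard = 2 * (q - 1)) ∧
    ({A : Matrix (Fin 2) (Fin 2) F | A.det = 1 ∧ ∃ c : F, c ≠ 0 ∧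
        Matrix.vecMul ![ξ, 1, 1, 0] (kron (matq q A) A) = c • ![ξ, 1, 1, 0]}).ncard
      = 2 * q ∧
    ({A : Matrix (Fin 2) (Fin 2) F | A.det = 1 ∧ ∃ c : F, c ≠ 0 ∧
        Matrix.vecMul ![ξ ^ (q - 1), ξ ^ (q - 1), 1, 0] (kron (matq q A) A)
          = c • ![ξ ^ (q - 1), ξ ^ (q - 1), 1, 0]}).ncard = 2 * q := by
  have hp3 : 3 ≤ p := by
    rcases hodd with ⟨k, hk⟩
    have := hp.two_le
    omega
  have hq3 : 3 ≤ q := hq ▸ hp3.trans (Nat.le_self_pow hn.ne' p)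
  have hqodd : Odd q := hq ▸ hodd.pow
  have hfact : Fact p.Prime := ⟨hp⟩
  have hchar : CharP F p := by
    apply charP_of_card_eq_prime_pow (f := n * 2)
    rw [hF, hq, pow_mul]
  have h2 : (2 : F) ≠ 0 := by
    have : ((2 : ℕ) : F) ≠ 0 := by
      rw [Ne, CharP.cast_eq_zero_iff F p]
      exact Nat.not_dvd_of_pos_of_lt two_pos hp3
    exact_mod_cast this
  have hξ0 : ξ ≠ 0 := by
    rintro rfl
    obtain ⟨m, hm⟩ := hξ (-1) (neg_ne_zero.mpr one_ne_zero)
    rcases eq_or_ne m 0 with rfl | h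
    · apply h2
      linear_combination -hm
    · simp [h] at hm
  have hprim := isPrimitiveRoot_of_forall_eq_pow hξ0 hξ
  rw [hF] at hprim
  obtain ⟨σ, hσ⟩ : ∃ σ : F →+* F, ∀ x, σ x = x ^ q :=
    ⟨iterateFrobenius F p n, fun x => by rw [iterateFrobenius_def, hq]⟩
  have hσσ : ∀ x, σ (σ x) = x := fun x => by
    rw [hσ, hσ, ← pow_mul, ← sq, ← hF, FiniteField.pow_card]
  have hN : q ^ 2 - 1 = (q - 1) * (q + 1) := by
    rw [mul_comm, ← Nat.sq_sub_sq, one_pow]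
  obtain ⟨k, hk⟩ := hqodd
  have hq1 : 0 < q ^ 2 - 1 := by
    rw [hN]
    exact Nat.mul_pos (by omega) (by omega)
  have hdiv1 : q - 1 ∣ q ^ 2 - 1 := ⟨q + 1, hN⟩
  have hdiv2 : 2 * (q - 1) ∣ q ^ 2 - 1 := ⟨k + 1, by
    rw [hN, show q + 1 = 2 * (k + 1) by omega]
    ring⟩
  have hdiv3 : 2 * (q + 1) ∣ q ^ 2 - 1 := ⟨k, by
    rw [hN, show q - 1 = 2 * k by omega]
    ring⟩
  have hσξ : ∀ j, ¬ (q + 1) ∣ j → σ (ξ ^ j) ≠ ξ ^ j := by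
    intro j hj h
    apply hj
    have hj0 : ξ ^ j ≠ 0 := pow_ne_zero _ hξ0
    have : ξ ^ (j * (q - 1)) = 1 := by
      apply mul_right_cancel₀ hj0
      rw [one_mul, pow_mul, ← pow_succ, Nat.sub_add_cancel (by omega), ← hσ, h]
    have := hprim.dvd_of_pow_eq_one _ this
    rw [hN, mul_comm] at this
    exact Nat.dvd_of_mul_dvd_mul_right (by omega) this
  have hnorm : ∀ j, ξ ^ j * σ (ξ ^ j) = 1 ↔ q - 1 ∣ j := by
    intro j
    rw [hσ, ← pow_succ', ← pow_mul, hprim.pow_eq_one_iff_dvd, hN]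
    exact Nat.mul_dvd_mul_iff_right (by omega)
  have hneg : (ξ ^ (k + 1)) ^ (q - 1) = -1 := by
    rw [← pow_mul]
    have hsq : (ξ ^ ((k + 1) * (q - 1))) ^ 2 = 1 := by
      rw [← pow_mul, hprim.pow_eq_one_iff_dvd, hN]
      refine ⟨1, ?_⟩
      rw [show q + 1 = 2 * (k + 1) by omega]
      ring
    rcases (mul_self_eq_one_iff.mp ((sq _).symm.trans hsq)) with h | h
    · have := Nat.le_of_dvd (Nat.mul_pos (by omega) (by omega)) (hprim.dvd_of_pow_eq_one _ h)
      rw [hN, mul_comm] at this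
      have := Nat.le_of_mul_le_mul_right this (by omega)
      omega
    · exact h
  have hcount := ncard_pow_eq_one hprim hq1 hdiv1
  refine ⟨?_, ?_, ?_, ?_, ?_⟩
  · rw [stabilizer_U q (by omega), ncard_image_diagonal, show {a : F | a ≠ 0} = {0}ᶜ from rfl,
      Set.ncard_compl, Set.ncard_singleton, Nat.card_eq_fintype_card, hF]
  · intro j hj1 hj2
    rw [stabilizer_R hσ hσσ (hσξ j (Nat.not_dvd_of_pos_of_lt hj1 (by omega))),
      ncard_image_diagonal, ncard_pow_eq_one hprim hq1 hdiv3]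
  · intro j hj1 hj2
    rw [stabilizer_Q hσ hσσ (by omega) (pow_ne_zero _ hξ0)
      ((hnorm j).not.mpr (Nat.not_dvd_of_pos_of_lt hj1 (by omega))),
      ncard_image_diagonal, ncard_pow_eq_one hprim hq1 hdiv2]
  · have hs := hσξ 1 (Nat.not_dvd_of_pos_of_lt one_pos (by omega))
    rw [pow_one] at hs
    have := ncard_pow_eq_mul (by omega) hcount (pow_ne_zero (k + 1) hξ0)
    simp only [hneg, neg_one_mul] at this
    rw [stabilizer_T₁ hσ hσσ hs, ncard_image_unitriangular h2, this]
  · have := ncard_pow_eq_mul (by omega) hcount (mul_ne_zero (pow_ne_zero (k + 1) hξ0) hξ0)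
    simp only [mul_pow _ ξ, hneg, neg_one_mul] at this
    rw [stabilizer_T₂ hσ hσσ ((hnorm _).mpr dvd_rfl), ncard_image_unitriangular h2, this]
    rw [Ne, hprim.pow_eq_one_iff_dvd, hN]
    apply Nat.not_dvd_of_pos_of_lt (by omega)
    exact lt_mul_of_one_lt_right (by omega) (by omega)
end
end

section
/- Let q be an odd prime power. Then H(3,q²) ∩ Q⁺(3,q²) = O, and more generally for any two distinct γ, γ′ ∈ 𝔽_{q²} one has C_γ ∩ C_{γ′} = O. In particular, any two distinct surfaces among the S_j (j ∈ {1,…,q}\{(q+1)/2}) and the E_k (k ∈ {0,…,q−1}\{(q−1)/2}) intersect exactly in O. -/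
noncomputable section

open Matrix

theorem Fgam_smul {F : Type*} [Field F] {q : ℕ} (hq : Odd q) (γ a : F) (v : Fin 4 → F) :
    Fgam q γ (a • v) = a ^ (q + 1) * Fgam q γ v := by
  obtain ⟨m, rfl⟩ := hq
  have h : (2 * m + 1 + 1) / 2 = m + 1 := by omega
  simp only [Fgam, h, Pi.smul_apply, smul_eq_mul]
  have h' : a * v 0 * (a * v 3) - a * v 1 * (a * v 2) = a ^ 2 * (v 0 * v 3 - v 1 * v 2) := by ring
  rw [h']
  simp only [mul_pow]
  ring

theorem mk_mem_Cgam {F : Type*} [Field F] {q : ℕ} (hq : Odd q) (γ : F) (v : Fin 4 → F)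
    (hv : v ≠ 0) : Projectivization.mk F v hv ∈ Cgam q γ ↔ Fgam q γ v = 0 := by
  refine ⟨fun h => h v hv rfl, fun h w hw hvw => ?_⟩
  obtain ⟨a, rfl⟩ := (Projectivization.mk_eq_mk_iff' F v w hv hw).1 hvw
  rw [Fgam_smul hq] at h
  refine (mul_eq_zero.1 h).resolve_left (pow_ne_zero _ ?_)
  rintro rfl
  exact hv (zero_smul F w)

theorem mk_mem_Qplus {F : Type*} [Field F] (v : Fin 4 → F) (hv : v ≠ 0) :
    Projectivization.mk F v hv ∈ Qplus F ↔ v 0 * v 3 - v 1 * v 2 = 0 := by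
  refine ⟨fun h => h v hv rfl, fun h w hw hvw => ?_⟩
  obtain ⟨a, rfl⟩ := (Projectivization.mk_eq_mk_iff' F v w hv hw).1 hvw
  have ha : a ≠ 0 := by
    rintro rfl
    exact hv (zero_smul F w)
  simp only [Pi.smul_apply, smul_eq_mul] at h
  refine (mul_eq_zero.1 (?_ : a ^ 2 * _ = 0)).resolve_left (pow_ne_zero _ ha)
  linear_combination h

/-- Two distinct surfaces `C_γ` meet exactly in the points of `C₀` on the hyperbolic quadric. -/
theorem Cgam_inter_Cgam {F : Type*} [Field F] {q : ℕ} (hq : Odd q) {γ γ' : F} (h : γ ≠ γ') :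
    Cgam q γ ∩ Cgam q γ' = Cgam q 0 ∩ Qplus F := by
  ext P
  induction P using Projectivization.ind with | h v hv =>
  have hm : (q + 1) / 2 ≠ 0 := by
    have := hq.pos
    omega
  simp only [Set.mem_inter_iff, mk_mem_Cgam hq, mk_mem_Qplus, Fgam]
  constructor
  · rintro ⟨h₁, h₂⟩
    have h₃ : (γ - γ') * (v 0 * v 3 - v 1 * v 2) ^ ((q + 1) / 2) = 0 := by
      linear_combination h₂ - h₁
    have h₄ := (mul_eq_zero.1 h₃).resolve_left (sub_ne_zero.2 h)
    refine ⟨?_, eq_zero_of_pow_eq_zero h₄⟩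
    linear_combination h₁ + γ * h₄
  · rintro ⟨h₁, h₂⟩
    rw [h₂, zero_pow hm] at h₁ ⊢
    constructor <;> linear_combination h₁

/-- The Hermitian surface meets the hyperbolic quadric in the Hermitian Veronese curve. -/
theorem Cgam_zero_inter_Qplus {F : Type*} [Field F] {q : ℕ} (hq : Odd q)
    (hF : ∀ x : F, (x ^ q) ^ q = x) : Cgam q (0 : F) ∩ Qplus F = Oset F q := by
  have hq0 : q ≠ 0 := hq.pos.ne'
  ext P
  constructor
  · induction P using Projectivization.ind with | h v hv =>
    simp only [Set.mem_inter_iff, mk_mem_Cgam hq, mk_mem_Qplus, Fgam]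
    rintro ⟨h₁, h₂⟩
    by_cases h0 : v 0 = 0
    · right
      simp only [h0, zero_pow hq0, zero_mul] at h₁ h₂
      have h12 : v 1 = 0 ∧ v 2 = 0 := by
        rcases mul_eq_zero.1 (show v 1 * v 2 = 0 by linear_combination -h₂) with h | h
        · refine ⟨h, eq_zero_of_pow_eq_zero (n := q + 1) ?_⟩
          rw [h, zero_pow q.succ_ne_zero] at h₁
          linear_combination -h₁
        · refine ⟨eq_zero_of_pow_eq_zero (n := q + 1) ?_, h⟩
          rw [h, zero_pow q.succ_ne_zero] at h₁
          linear_combination -h₁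
      have hne : (![0, 0, 0, 1] : Fin 4 → F) ≠ 0 := fun h => one_ne_zero (congrFun h 3)
      refine ⟨hne, (Projectivization.mk_eq_mk_iff' F _ _ hv hne).2 ⟨v 3, ?_⟩⟩
      ext i
      fin_cases i <;> simp [h0, h12]
    · left
      obtain ⟨t, ht⟩ : ∃ t, v 1 = v 0 * t := ⟨v 1 / v 0, by field_simp⟩
      obtain ⟨s, hs⟩ : ∃ s, v 2 = v 0 * s := ⟨v 2 / v 0, by field_simp⟩
      have h3 : v 3 = v 0 * (t * s) := by
        apply mul_left_cancel₀ h0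
        rw [ht, hs] at h₂
        linear_combination h₂
      have h₄ : v 0 ^ (q + 1) * ((t - s ^ q) * (s - t ^ q)) = 0 := by
        rw [ht, hs, h3] at h₁
        simp only [mul_pow] at h₁
        linear_combination h₁
      have hst : s = t ^ q := by
        rcases mul_eq_zero.1 ((mul_eq_zero.1 h₄).resolve_left (pow_ne_zero _ h0)) with h | h
        · rw [sub_eq_zero.1 h, hF]
        · exact sub_eq_zero.1 h
      have hne : ![1, t, t ^ q, t ^ (q + 1)] ≠ 0 := fun h => one_ne_zero (congrFun h 0)
      refine ⟨t, hne, (Projectivization.mk_eq_mk_iff' F _ _ hv hne).2 ⟨v 0, ?_⟩⟩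
      ext i
      fin_cases i <;> simp [ht, hs, h3, hst, pow_succ']
  · rintro (⟨t, hv, rfl⟩ | ⟨hv, rfl⟩)
    · simp only [Set.mem_inter_iff, mk_mem_Cgam hq, mk_mem_Qplus, Fgam, Matrix.cons_val]
      constructor
      · simp only [pow_succ, mul_pow, hF]
        ring
      · ring
    · simp [mk_mem_Cgam hq, mk_mem_Qplus, Fgam, hq0]

/-- Lemma 2.6 i): `H(3,q²) ∩ Q⁺(3,q²) = O`, and for distinct `γ, γ'` one has
    `C_γ ∩ C_{γ'} = O`. -/
theorem stmt3 {F : Type*} [Field F] [Fintype F] (p n q : ℕ) (hp : p.Prime)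
    (hodd : Odd p) (hn : 0 < n) (hq : q = p ^ n) (hF : Fintype.card F = q ^ 2) :
    Cgam q (0 : F) ∩ Qplus F = Oset F q ∧
    ∀ γ γ' : F, γ ≠ γ' → Cgam q γ ∩ Cgam q γ' = Oset F q := by
  have hq' : Odd q := hq ▸ hodd.pow
  have hO : Cgam q (0 : F) ∩ Qplus F = Oset F q := Cgam_zero_inter_Qplus hq' fun x => by
    rw [← pow_mul, ← sq, ← hF, FiniteField.pow_card]
  exact ⟨hO, fun γ γ' h => (Cgam_inter_Cgam hq' h).trans hO⟩
end
end
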